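/- Let L = ℚ(√d) be a real quadratic field (d ≥ 2 squarefree). There exists a chain of finite subsets 𝒰_0 ⊆ 𝒰_1 ⊆ 𝒰_2 ⊆ ⋯ of O_L^×, depending only on L, with the following property: whenever r ∈ ℕ, n ∈ ℤ∖{0}, and u = (u_1,…,u_r) ∈ (O_L^×)^r satisfy n = u_1 + ⋯ + u_r with no vanishing subsum, then there exist ℓ, s ∈ ℕ_0 with 2ℓ + s ≤ r, a tuple v ∈ (O_L^×)^ℓ, and a tuple ξ ∈ 𝒰_s^s, such that n = v_1 + ⋯ + v_ℓ + v_1' + ⋯ + v_ℓ' + ξ_1 + ⋯ + ξ_s and, moreover, this latter representation of n has no vanishing subsum. -/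

import Mathlib

open NumberField IntermediateField

/-- A family of elements of an additive monoid has no vanishing subsum if the sum over
every nonempty (finite) subset of indices is nonzero. -/
def NoVanishingSubsum {ι R : Type*} [AddCommMonoid R] (w : ι → R) : Prop :=
  ∀ I : Finset ι, I.Nonempty → ∑ i ∈ I, w i ≠ 0

/-- Among `s` real numbers, one of which exceeds `q ^ s`, some interval `(q ^ j, q ^ (j + 1)]`
with `j < s` contains none. -/
lemma exists_pow_gap {s : ℕ} {q : ℝ} (hq : 1 ≤ q) (h : Fin s → ℝ) (i₀ : Fin s)
    (hi₀ : q ^ s < h i₀) : ∃ j < s, ∀ i, q ^ j < h i → q ^ (j + 1) < h i := by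
  by_contra! hcon
  choose f hf₁ hf₂ using fun j : Fin s => hcon j j.2
  have hinj : Function.Injective f := by
    have hne : ∀ a b : Fin s, a < b → f a ≠ f b := by
      intro a b hab hfab
      have h₁ := hf₂ a
      have h₂ := hf₁ b
      rw [← hfab] at h₂
      have h₃ : q ^ ((a : ℕ) + 1) ≤ q ^ (b : ℕ) := pow_le_pow_right₀ hq (by omega)
      linarith
    intro a b hab
    by_contra hn
    rcases lt_or_gt_of_ne hn with hlt | hlt
    · exact hne _ _ hlt hab
    · exact hne _ _ hlt hab.symm
  obtain ⟨j, rfl⟩ := (Finite.injective_iff_surjective.mp hinj) i₀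
  have := hf₂ j
  have h₃ : q ^ ((j : ℕ) + 1) ≤ q ^ s := pow_le_pow_right₀ hq (by omega)
  linarith

/-- If a family has a gap between sizes `T` and `q * T`, then the parts of the family that are
large in the first, respectively the second, coordinate nearly agree after conjugation. -/
lemma abs_mul_abs_lt_one_of_gap {s : ℕ} {T q : ℝ} (hT : 1 ≤ T) (hq : 2 * (s : ℝ) ^ 2 < q)
    (x y : Fin s → ℝ) (hxy : ∀ i, |x i| * |y i| = 1) (hsum : ∑ i, x i = ∑ i, y i)
    (hx : ∀ i, T < |x i| → q * T < |x i|) (hy : ∀ i, T < |y i| → q * T < |y i|) :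
    |(∑ i with T < |x i|, x i) - ∑ i with T < |y i|, y i| *
      |(∑ i with T < |x i|, y i) - ∑ i with T < |y i|, x i| < 1 := by
  have hq0 : 0 < q := lt_of_le_of_lt (by positivity) hq
  have hT0 : 0 < T := by linarith
  have small : ∀ a b : ℝ, |a| * |b| = 1 → T < |a| → |b| ≤ 1 := by
    intro a b hab ha
    nlinarith [abs_nonneg b]
  have tiny : ∀ a b : ℝ, |a| * |b| = 1 → q * T < |a| → |b| ≤ 1 / (q * T) := by
    intro a b hab ha
    rw [le_div_iff₀ (by positivity)]
    nlinarith [abs_nonneg b]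
  have hyx : ∀ i, |y i| * |x i| = 1 := fun i => by rw [mul_comm, hxy]
  have h₁ : |(∑ i with T < |x i|, x i) - ∑ i with T < |y i|, y i| ≤ s * (2 * T) := by
    have : (∑ i with T < |x i|, x i) - ∑ i with T < |y i|, y i
        = ∑ i, ((if T < |y i| then 0 else y i) - if T < |x i| then 0 else x i) := by
      simp only [Finset.sum_filter]
      rw [← sub_eq_zero, ← Finset.sum_sub_distrib, ← Finset.sum_sub_distrib]
      rw [← sub_eq_zero, ← Finset.sum_sub_distrib] at hsum
      rw [← hsum]
      refine Finset.sum_congr rfl fun i _ => ?_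
      split_ifs <;> ring
    rw [this]
    refine (Finset.abs_sum_le_sum_abs _ _).trans ?_
    have hb : ∀ i ∈ Finset.univ,
        |(if T < |y i| then 0 else y i) - if T < |x i| then 0 else x i| ≤ 2 * T := by
      intro i _
      have hz : ∀ z : ℝ, |if T < |z| then 0 else z| ≤ T := by
        intro z
        split_ifs with h
        · simpa using hT0.le
        · exact not_lt.mp h
      exact (abs_sub _ _).trans (by linarith [hz (x i), hz (y i)])
    simpa using Finset.sum_le_sum hb
  have h₂ : |(∑ i with T < |x i|, y i) - ∑ i with T < |y i|, x i| ≤ s * (1 / (q * T)) := by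
    simp only [Finset.sum_filter]
    rw [← Finset.sum_sub_distrib]
    refine (Finset.abs_sum_le_sum_abs _ _).trans ?_
    have hb : ∀ i ∈ Finset.univ,
        |(if T < |x i| then y i else 0) - if T < |y i| then x i else 0| ≤ 1 / (q * T) := by
      intro i _
      split_ifs with hxi hyi hyi
      · have := small _ _ (hxy i) hxi
        linarith
      · simpa using tiny _ _ (hxy i) (hx i hxi)
      · simpa using tiny _ _ (hyx i) (hy i hyi)
      · simp only [sub_self, abs_zero]
        positivity
    simpa using Finset.sum_le_sum hb
  calc _ ≤ (s * (2 * T)) * (s * (1 / (q * T))) :=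
        mul_le_mul h₁ h₂ (abs_nonneg _) (by positivity)
    _ = 2 * (s : ℝ) ^ 2 / q := by field_simp
    _ < 1 := (div_lt_one hq0).mpr hq

section QuadraticField

variable {d : ℕ} {L : IntermediateField ℚ ℝ}

lemma exists_rat_add_rat_mul (hL : L = ℚ⟮(Real.sqrt d)⟯) :
    ∃ θ : L, θ ^ 2 = d ∧ ∀ x : L, ∃ a b : ℚ, x = a + b * θ := by
  subst hL
  let θ : ℚ⟮(Real.sqrt d)⟯ := AdjoinSimple.gen ℚ (Real.sqrt d)
  have hθ : θ ^ 2 = d := by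
    apply Subtype.ext
    simp [θ]
  refine ⟨θ, hθ, fun x => ?_⟩
  have h_int : IsIntegral ℚ (Real.sqrt d) :=
    ⟨Polynomial.X ^ 2 - Polynomial.C (d : ℚ), Polynomial.monic_X_pow_sub_C _ two_ne_zero, by simp⟩
  have hx : x ∈ Algebra.adjoin ℚ {θ} := by
    have := (adjoin.powerBasis h_int).adjoin_gen_eq_top
    rw [adjoin.powerBasis_gen] at this
    exact this ▸ Algebra.mem_top
  induction hx using Algebra.adjoin_induction with
  | mem x hx => exact ⟨0, 1, by simpa using hx⟩
  | algebraMap r => exact ⟨r, 0, by simp⟩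
  | add x y _ _ hx hy =>
    obtain ⟨a, b, rfl⟩ := hx
    obtain ⟨a', b', rfl⟩ := hy
    exact ⟨a + a', b + b', by push_cast; ring⟩
  | mul x y _ _ hx hy =>
    obtain ⟨a, b, rfl⟩ := hx
    obtain ⟨a', b', rfl⟩ := hy
    exact ⟨a * a' + b * b' * d, a * b' + a' * b, by push_cast; linear_combination b * b' * hθ⟩

lemma map_eq_neg_of_ne_refl {θ : L} (hθ : θ ^ 2 = d) (hspan : ∀ x : L, ∃ a b : ℚ, x = a + b * θ)
    {σ : L ≃ₐ[ℚ] L} (hσ : σ ≠ AlgEquiv.refl) : σ θ = -θ := by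
  have h : σ θ ^ 2 = θ ^ 2 := by rw [← map_pow, hθ, map_natCast]
  refine (sq_eq_sq_iff_eq_or_eq_neg.mp h).resolve_left fun h => hσ ?_
  ext x
  obtain ⟨a, b, rfl⟩ := hspan x
  simp [h]

lemma conj_conj (hL : L = ℚ⟮(Real.sqrt d)⟯) {σ : L ≃ₐ[ℚ] L} (hσ : σ ≠ AlgEquiv.refl) (x : L) :
    σ (σ x) = x := by
  obtain ⟨θ, hθ, hspan⟩ := exists_rat_add_rat_mul hL
  obtain ⟨a, b, rfl⟩ := hspan x
  simp [map_eq_neg_of_ne_refl hθ hspan hσ]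

lemma exists_int_eq_mul_conj (hL : L = ℚ⟮(Real.sqrt d)⟯) {σ : L ≃ₐ[ℚ] L}
    (hσ : σ ≠ AlgEquiv.refl) (x : 𝓞 L) : ∃ m : ℤ, (x : L) * σ x = m := by
  obtain ⟨θ, hθ, hspan⟩ := exists_rat_add_rat_mul hL
  obtain ⟨a, b, hx⟩ := hspan x
  have hN : (x : L) * σ x = algebraMap ℚ L (a ^ 2 - d * b ^ 2) := by
    rw [hx]
    simp [map_eq_neg_of_ne_refl hθ hspan hσ]
    linear_combination (-(b : L) ^ 2) * hθ
  have h_int : IsIntegral ℤ ((x : L) * σ x) :=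
    x.isIntegral_coe.mul (x.isIntegral_coe.map (σ.toAlgHom.restrictScalars ℤ))
  rw [hN, isIntegral_algebraMap_iff (algebraMap ℚ L).injective] at h_int
  obtain ⟨m, hm⟩ := IsIntegrallyClosed.isIntegral_iff.mp h_int
  exact ⟨m, by rw [hN, ← hm]; simp⟩

lemma abs_mul_abs_conj (hL : L = ℚ⟮(Real.sqrt d)⟯) {σ : L ≃ₐ[ℚ] L}
    (hσ : σ ≠ AlgEquiv.refl) (u : (𝓞 L)ˣ) :
    |(((u : 𝓞 L) : L) : ℝ)| * |((σ ((u : 𝓞 L) : L) : L) : ℝ)| = 1 := by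
  obtain ⟨m, hm⟩ := exists_int_eq_mul_conj hL hσ (u : 𝓞 L)
  obtain ⟨k, hk⟩ := exists_int_eq_mul_conj hL hσ ((u⁻¹ : (𝓞 L)ˣ) : 𝓞 L)
  have hu : ((u : 𝓞 L) : L) * (((u⁻¹ : (𝓞 L)ˣ) : 𝓞 L) : L) = 1 := by
    rw [← map_mul, Units.mul_inv, map_one]
  have hmk : m * k = 1 := by
    have : (m : L) * k = 1 := by
      rw [← hm, ← hk, mul_mul_mul_comm, hu, ← map_mul, hu, map_one, mul_one]
    exact_mod_cast this
  have h1 : |m| = 1 := Int.isUnit_iff_abs_eq.mp (IsUnit.of_mul_eq_one _ hmk)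
  rw [← abs_mul, ← MulMemClass.coe_mul, hm]
  simp only [SubringClass.coe_intCast]
  exact_mod_cast h1

lemma eq_zero_of_abs_mul_abs_conj_lt_one (hL : L = ℚ⟮(Real.sqrt d)⟯) {σ : L ≃ₐ[ℚ] L}
    (hσ : σ ≠ AlgEquiv.refl) (x : 𝓞 L)
    (h : |((x : L) : ℝ)| * |((σ (x : L) : L) : ℝ)| < 1) : (x : L) = 0 := by
  obtain ⟨m, hm⟩ := exists_int_eq_mul_conj hL hσ x
  rw [← abs_mul, ← MulMemClass.coe_mul, hm, SubringClass.coe_intCast] at h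
  have h0 : m = 0 := Int.abs_lt_one_iff.mp (by exact_mod_cast h)
  rw [h0, Int.cast_zero, mul_eq_zero] at hm
  exact hm.elim id fun h => (map_eq_zero σ).mp h

lemma exists_unit_eq_conj (σ : L ≃ₐ[ℚ] L) (u : (𝓞 L)ˣ) :
    ∃ w : (𝓞 L)ˣ, ((w : 𝓞 L) : L) = σ ((u : 𝓞 L) : L) :=
  ⟨Units.map (RingOfIntegers.mapRingHom σ : 𝓞 L →+* 𝓞 L) u, rfl⟩

lemma finite_units_abs_le (hL : L = ℚ⟮(Real.sqrt d)⟯) {σ : L ≃ₐ[ℚ] L}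
    (hσ : σ ≠ AlgEquiv.refl) (C : ℝ) :
    {u : (𝓞 L)ˣ | |(((u : 𝓞 L) : L) : ℝ)| ≤ C ∧ |((σ ((u : 𝓞 L) : L) : L) : ℝ)| ≤ C}.Finite := by
  have hfd : FiniteDimensional ℚ L := by
    subst hL
    exact adjoin.finiteDimensional
      ⟨Polynomial.X ^ 2 - Polynomial.C (d : ℚ), Polynomial.monic_X_pow_sub_C _ two_ne_zero, by simp⟩
  have : NumberField L := { to_charZero := inferInstance, to_finiteDimensional := hfd }
  obtain ⟨θ, hθ, hspan⟩ := exists_rat_add_rat_mul hL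
  have hσθ := map_eq_neg_of_ne_refl hθ hspan hσ
  let ι : L →+* ℂ := Complex.ofRealHom.comp (algebraMap L ℝ)
  have key : ∀ (φ : L →+* ℂ) (x : L), φ x = ι x ∨ φ x = ι (σ x) := by
    intro φ x
    have h : φ θ ^ 2 = ι θ ^ 2 := by rw [← map_pow, ← map_pow, hθ, map_natCast, map_natCast]
    obtain ⟨a, b, rfl⟩ := hspan x
    refine (sq_eq_sq_iff_eq_or_eq_neg.mp h).imp (fun h => ?_) fun h => ?_
    · simp only [map_add, map_mul, map_ratCast, h]
    · simp only [map_add, map_mul, map_ratCast, h, hσθ, map_neg]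
  have hι : ∀ x : L, ‖ι x‖ = |(x : ℝ)| := fun x => Complex.norm_real _
  refine ((Embeddings.finite_of_norm_le L ℂ C).preimage
    (f := fun u : (𝓞 L)ˣ => ((u : 𝓞 L) : L)) ?_).subset ?_
  · exact (RingOfIntegers.coe_injective.comp Units.val_injective).injOn
  · rintro u ⟨h₁, h₂⟩
    refine ⟨(u : 𝓞 L).isIntegral_coe, fun φ => ?_⟩
    rcases key φ ((u : 𝓞 L) : L) with h | h <;> rw [h, hι] <;> assumption

/-- `n` is the sum of the traces of `ℓ` units and of `s` further units. -/
def IsTraceSum (σ : L ≃ₐ[ℚ] L) (n : ℤ) (ℓ s : ℕ) : Prop :=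
  ∃ v : Fin ℓ → (𝓞 L)ˣ, ∃ ξ : Fin s → (𝓞 L)ˣ,
    (n : L) = ∑ i, ((v i : 𝓞 L) : L) + ∑ i, σ ((v i : 𝓞 L) : L) + ∑ j, ((ξ j : 𝓞 L) : L)

lemma IsTraceSum.of_finset {σ : L ≃ₐ[ℚ] L} {n : ℤ} {α β : Type*} (A : Finset α) (B : Finset β)
    (v : α → (𝓞 L)ˣ) (ξ : β → (𝓞 L)ˣ)
    (h : (n : L) = ∑ i ∈ A, ((v i : 𝓞 L) : L) + ∑ i ∈ A, σ ((v i : 𝓞 L) : L)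
      + ∑ j ∈ B, ((ξ j : 𝓞 L) : L)) : IsTraceSum σ n A.card B.card := by
  refine ⟨fun i => v (A.equivFin.symm i), fun j => ξ (B.equivFin.symm j), ?_⟩
  rw [h, ← Finset.sum_coe_sort A, ← Finset.sum_coe_sort A, ← Finset.sum_coe_sort B]
  congr 1
  · congr 1
    · exact (Equiv.sum_comp A.equivFin.symm (fun i : A => ((v i : 𝓞 L) : L))).symm
    · exact (Equiv.sum_comp A.equivFin.symm (fun i : A => σ ((v i : 𝓞 L) : L))).symm
  · exact (Equiv.sum_comp B.equivFin.symm (fun j : B => ((ξ j : 𝓞 L) : L))).symm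

/-- A subset of `α ⊕ α ⊕ β` splits into the pairs `A` of its elements in the two copies of `α`
and the unpaired rest `B`. -/
lemma exists_pairs_and_rest {α β : Type*} [Fintype α] [Fintype β] (J : Finset (α ⊕ α ⊕ β)) :
    ∃ (A : Finset α) (B : Finset (α ⊕ α ⊕ β)), ∀ {M : Type} [AddCommMonoid M]
      (f : α ⊕ α ⊕ β → M),
      ∑ x ∈ J, f x = ∑ i ∈ A, (f (.inl i) + f (.inr (.inl i))) + ∑ x ∈ B, f x := by
  classical
  refine ⟨Finset.univ.filter fun i => .inl i ∈ J ∧ .inr (.inl i) ∈ J,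
    J.filter fun x => ∀ i, .inl i ∈ J → .inr (.inl i) ∈ J → x ≠ .inl i ∧ x ≠ .inr (.inl i),
    fun {M} _ f => ?_⟩
  have hJ : ∀ g : α ⊕ α ⊕ β → M, ∑ x ∈ J, g x = ∑ x, if x ∈ J then g x else 0 := by simp
  rw [Finset.sum_filter, Finset.sum_filter, hJ, hJ]
  simp only [Fintype.sum_sum_type, ← add_assoc, ← Finset.sum_add_distrib]
  congr 1
  · refine Finset.sum_congr rfl fun i _ => ?_
    by_cases h₁ : Sum.inl i ∈ J <;> by_cases h₂ : Sum.inr (Sum.inl i) ∈ J <;>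
      simp [h₁, h₂]; grind
  · simp

/-- A vanishing subsum can be deleted, which makes the representation shorter. -/
lemma exists_shorter_of_vanishing {σ : L ≃ₐ[ℚ] L} {n : ℤ} {ℓ s : ℕ} (v : Fin ℓ → (𝓞 L)ˣ)
    (ξ : Fin s → (𝓞 L)ˣ)
    (h : (n : L) = ∑ i, ((v i : 𝓞 L) : L) + ∑ i, σ ((v i : 𝓞 L) : L) + ∑ j, ((ξ j : 𝓞 L) : L))
    (hv : ¬ NoVanishingSubsum (Sum.elim (fun i : Fin ℓ => ((v i : 𝓞 L) : L))
              (Sum.elim (fun i : Fin ℓ => σ ((v i : 𝓞 L) : L))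
                (fun j : Fin s => ((ξ j : 𝓞 L) : L))))) :
    ∃ ℓ' s', 2 * ℓ' + s' < 2 * ℓ + s ∧ IsTraceSum σ n ℓ' s' := by
  classical
  choose c hc using exists_unit_eq_conj σ
  simp only [NoVanishingSubsum, not_forall, not_not] at hv
  obtain ⟨I, hI, hI0⟩ := hv
  let w : Fin ℓ ⊕ Fin ℓ ⊕ Fin s → (𝓞 L)ˣ := Sum.elim v (Sum.elim (fun i => c (v i)) ξ)
  have hw : (Sum.elim (fun i : Fin ℓ => ((v i : 𝓞 L) : L))
      (Sum.elim (fun i : Fin ℓ => σ ((v i : 𝓞 L) : L)) (fun j : Fin s => ((ξ j : 𝓞 L) : L))))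
      = fun x => ((w x : 𝓞 L) : L) := by
    ext x
    rcases x with i | i | j <;> simp [w, hc]
  rw [hw] at hI0
  have hJ : (n : L) = ∑ x ∈ Iᶜ, ((w x : 𝓞 L) : L) := by
    have := Finset.sum_compl_add_sum I fun x => ((w x : 𝓞 L) : L)
    rw [hI0, add_zero] at this
    rw [this, h]
    simp [w, hc, add_assoc]
  obtain ⟨A, B, hAB⟩ := exists_pairs_and_rest Iᶜ
  rw [hAB] at hJ
  refine ⟨_, _, ?_, IsTraceSum.of_finset A B v w (hJ.trans ?_)⟩
  · have hcard := hAB fun _ => (1 : ℕ)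
    have hlt : Iᶜ.card < 2 * ℓ + s := by
      have := Finset.card_compl_add_card I
      have := hI.card_pos
      simp only [Fintype.card_sum, Fintype.card_fin] at *
      omega
    simp only [Finset.sum_const, smul_eq_mul] at hcard
    omega
  · rw [Finset.sum_add_distrib]
    simp [w, hc]

/-- The size bound defining the finite sets of units in the reduction. -/
def sizeBound (s : ℕ) : ℝ := (2 * (s : ℝ) ^ 2 + 1) ^ s

lemma sizeBound_mono : Monotone sizeBound := by
  intro a b hab
  unfold sizeBound
  have hab' : (a : ℝ) ≤ b := by exact_mod_cast hab
  calc (2 * (a : ℝ) ^ 2 + 1) ^ a ≤ (2 * (b : ℝ) ^ 2 + 1) ^ a := by gcongr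
    _ ≤ _ := pow_le_pow_right₀ (by nlinarith [sq_nonneg (b : ℝ)]) hab

/-- If some `ξ j` is large, then the large `ξ`s can be traded for traces. -/
lemma exists_fewer_of_large (hL : L = ℚ⟮(Real.sqrt d)⟯) {σ : L ≃ₐ[ℚ] L}
    (hσ : σ ≠ AlgEquiv.refl) {n : ℤ} {ℓ s : ℕ} (v : Fin ℓ → (𝓞 L)ˣ)
    (ξ : Fin s → (𝓞 L)ˣ)
    (h : (n : L) = ∑ i, ((v i : 𝓞 L) : L) + ∑ i, σ ((v i : 𝓞 L) : L) + ∑ j, ((ξ j : 𝓞 L) : L))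
    (j₀ : Fin s) (hj₀ : ¬ (|(((ξ j₀ : 𝓞 L) : L) : ℝ)| ≤ sizeBound s ∧
      |((σ ((ξ j₀ : 𝓞 L) : L) : L) : ℝ)| ≤ sizeBound s)) :
    ∃ ℓ' s', 2 * ℓ' + s' ≤ 2 * ℓ + s ∧ s' < s ∧ IsTraceSum σ n ℓ' s' := by
  classical
  set x : Fin s → ℝ := fun j => (((ξ j : 𝓞 L) : L) : ℝ) with hx
  set y : Fin s → ℝ := fun j => ((σ ((ξ j : 𝓞 L) : L) : L) : ℝ) with hy
  have hxy : ∀ j, |x j| * |y j| = 1 := fun j => abs_mul_abs_conj hL hσ (ξ j)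
  have hsumL : ∑ j, ((ξ j : 𝓞 L) : L) = ∑ j, σ ((ξ j : 𝓞 L) : L) := by
    have h' := congrArg σ h
    simp only [map_add, map_sum, conj_conj hL hσ, map_intCast] at h'
    linear_combination h' - h
  have hsum : ∑ j, x j = ∑ j, y j := by
    have := congrArg (fun z : L => (z : ℝ)) hsumL
    simpa [hx, hy] using this
  have hq1 : (1 : ℝ) ≤ 2 * (s : ℝ) ^ 2 + 1 := by nlinarith [sq_nonneg (s : ℝ)]
  obtain ⟨k, hks, hk⟩ := exists_pow_gap hq1 (fun j => max |x j| |y j|) j₀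
    (by rw [not_and_or, not_le, not_le] at hj₀; exact lt_max_iff.mpr hj₀)
  set q : ℝ := 2 * (s : ℝ) ^ 2 + 1 with hq
  have hT : 1 ≤ q ^ k := one_le_pow₀ hq1
  have hj₀T : q ^ k < |x j₀| ∨ q ^ k < |y j₀| := by
    have hks' : q ^ k ≤ sizeBound s := pow_le_pow_right₀ hq1 hks.le
    rw [not_and_or, not_le, not_le] at hj₀
    exact hj₀.imp hks'.trans_lt hks'.trans_lt
  rw [pow_succ'] at hk
  set T : ℝ := q ^ k with hTdef
  have hsmall : ∀ a b : ℝ, |a| * |b| = 1 → T < |a| → |b| < T := by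
    intro a b hab ha
    nlinarith [abs_nonneg b]
  have hxT : ∀ j, T < |x j| → q * T < |x j| := by
    intro j hj
    rw [← max_eq_left (hsmall _ _ (hxy j) hj |>.trans hj).le]
    exact hk j (lt_max_of_lt_left hj)
  have hyT : ∀ j, T < |y j| → q * T < |y j| := by
    intro j hj
    rw [← max_eq_right (hsmall _ _ ((mul_comm _ _).trans (hxy j)) hj |>.trans hj).le]
    exact hk j (lt_max_of_lt_right hj)
  have hlt := abs_mul_abs_lt_one_of_gap hT (by rw [hq]; linarith) x y hxy hsum hxT hyT
  set P : Finset (Fin s) := {j | T < |x j|} with hP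
  set Q : Finset (Fin s) := {j | T < |y j|} with hQ
  set R : Finset (Fin s) := {j | ¬ T < |x j| ∧ ¬ T < |y j|} with hR
  have hsplit : ∀ {M : Type} [AddCommMonoid M] (f : Fin s → M),
      ∑ j, f j = ∑ j ∈ P, f j + ∑ j ∈ Q, f j + ∑ j ∈ R, f j := by
    intro M _ f
    simp only [hP, hQ, hR, Finset.sum_filter, ← Finset.sum_add_distrib]
    refine Finset.sum_congr rfl fun j _ => ?_
    by_cases h₁ : T < |x j| <;> by_cases h₂ : T < |y j|
    · exact absurd (hsmall _ _ (hxy j) h₁) h₂.not_gt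
    all_goals simp [h₁, h₂]
  choose c hc using exists_unit_eq_conj σ
  have hPQ : ∑ j ∈ P, ((ξ j : 𝓞 L) : L) = ∑ j ∈ Q, σ ((ξ j : 𝓞 L) : L) := by
    have h0 := eq_zero_of_abs_mul_abs_conj_lt_one hL hσ
      (∑ j ∈ P, (ξ j : 𝓞 L) - ∑ j ∈ Q, (c (ξ j) : 𝓞 L)) (by
        simpa [hc, conj_conj hL hσ, hx, hy] using hlt)
    simpa [hc, sub_eq_zero] using h0
  have hQP : ∑ j ∈ Q, ((ξ j : 𝓞 L) : L) = ∑ j ∈ P, σ ((ξ j : 𝓞 L) : L) := by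
    have := congrArg σ hPQ
    simpa [conj_conj hL hσ] using this.symm
  have hcard : s = P.card + Q.card + R.card := by
    simpa only [Finset.sum_const, Finset.card_univ, Fintype.card_fin, smul_eq_mul, mul_one]
      using hsplit fun _ => (1 : ℕ)
  have hRs : R.card < s := by
    have : j₀ ∉ R := by simp [hR, imp_iff_not_or]; tauto
    simpa using Finset.card_lt_univ_of_notMem this
  rw [hsplit fun j => ((ξ j : 𝓞 L) : L)] at h
  have trade : ∀ A : Finset (Fin s), 2 * A.card ≤ P.card + Q.card →
      ∑ j ∈ P, ((ξ j : 𝓞 L) : L) + ∑ j ∈ Q, ((ξ j : 𝓞 L) : L)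
        = ∑ j ∈ A, ((ξ j : 𝓞 L) : L) + ∑ j ∈ A, σ ((ξ j : 𝓞 L) : L) →
      ∃ ℓ' s', 2 * ℓ' + s' ≤ 2 * ℓ + s ∧ s' < s ∧ IsTraceSum σ n ℓ' s' := by
    intro A hA hsumA
    refine ⟨_, _, ?_, hRs, IsTraceSum.of_finset (Finset.univ.disjSum A) R (Sum.elim v ξ) ξ ?_⟩
    · simp only [Finset.card_disjSum, Finset.card_univ, Fintype.card_fin]
      omega
    · simp only [Finset.sum_disjSum, Sum.elim_inl, Sum.elim_inr]
      linear_combination h + hsumA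
  rcases le_total P.card Q.card with hle | hle
  · exact trade P (by omega) (by rw [hQP])
  · exact trade Q (by omega) (by rw [hPQ, add_comm])

end QuadraticField

/-- Corollary 5 (reduction to unit trace sums, with no vanishing subsum): there is a chain
of finite sets of units `𝒰₀ ⊆ 𝒰₁ ⊆ ⋯` such that any representation of a nonzero integer
`n` as a sum of `r` units with no vanishing subsum can be replaced by a representation
`n = v₁ + ⋯ + v_ℓ + v₁' + ⋯ + v_ℓ' + ξ₁ + ⋯ + ξ_s` with `2ℓ + s ≤ r`, all `ξ_j ∈ 𝒰_s`,
which again has no vanishing subsum. -/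
theorem trace_sum_reduction_no_vanishing_subsum
    (d : ℕ) (hd : 2 ≤ d) (hsf : Squarefree d)
    (L : IntermediateField ℚ ℝ) (hL : L = ℚ⟮(Real.sqrt d)⟯)
    (σ : L ≃ₐ[ℚ] L) (hσ : σ ≠ AlgEquiv.refl) :
    ∃ U : ℕ → Finset (𝓞 L)ˣ, (∀ t : ℕ, U t ⊆ U (t + 1)) ∧
      ∀ r : ℕ, 1 ≤ r → ∀ n : ℤ, n ≠ 0 → ∀ u : Fin r → (𝓞 L)ˣ,
        (n : L) = ∑ i, ((u i : 𝓞 L) : L) →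
        NoVanishingSubsum (fun i : Fin r => ((u i : 𝓞 L) : L)) →
        ∃ ℓ s : ℕ, 2 * ℓ + s ≤ r ∧
          ∃ v : Fin ℓ → (𝓞 L)ˣ, ∃ ξ : Fin s → (𝓞 L)ˣ,
            (∀ j, ξ j ∈ U s) ∧
            (n : L) = ∑ i, ((v i : 𝓞 L) : L) + ∑ i, σ ((v i : 𝓞 L) : L)
              + ∑ j, ((ξ j : 𝓞 L) : L) ∧
            NoVanishingSubsum (Sum.elim (fun i : Fin ℓ => ((v i : 𝓞 L) : L))
              (Sum.elim (fun i : Fin ℓ => σ ((v i : 𝓞 L) : L))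
                (fun j : Fin s => ((ξ j : 𝓞 L) : L)))) := by
  classical
  refine ⟨fun t => (finite_units_abs_le hL hσ (sizeBound t)).toFinset, fun t u hu => ?_, ?_⟩
  · rw [Set.Finite.mem_toFinset] at hu ⊢
    have := sizeBound_mono t.le_succ
    exact ⟨hu.1.trans this, hu.2.trans this⟩
  intro r _ n _ u hu _
  have hex : ∃ t ℓ s, 2 * ℓ + s = t ∧ IsTraceSum σ n ℓ s :=
    ⟨r, 0, r, by omega, Fin.elim0, u, by simpa using hu⟩
  have hle : Nat.find hex ≤ r :=
    Nat.find_min' hex ⟨0, r, by omega, Fin.elim0, u, by simpa using hu⟩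
  have hshort : ∀ ℓ s, IsTraceSum σ n ℓ s → Nat.find hex ≤ 2 * ℓ + s :=
    fun ℓ s h => Nat.find_min' hex ⟨ℓ, s, rfl, h⟩
  have hex' : ∃ s ℓ, 2 * ℓ + s = Nat.find hex ∧ IsTraceSum σ n ℓ s := by
    obtain ⟨ℓ, s, h⟩ := Nat.find_spec hex
    exact ⟨s, ℓ, h⟩
  obtain ⟨ℓ, hℓ, v, ξ, hvξ⟩ := Nat.find_spec hex'
  refine ⟨ℓ, Nat.find hex', hℓ.trans_le hle, v, ξ, fun j => ?_, hvξ, ?_⟩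
  · rw [Set.Finite.mem_toFinset]
    by_contra hj
    obtain ⟨ℓ', s', h₁, h₂, h₃⟩ := exists_fewer_of_large hL hσ v ξ hvξ j hj
    exact Nat.find_min hex' h₂ ⟨ℓ', (h₁.trans_eq hℓ).antisymm (hshort _ _ h₃), h₃⟩
  · by_contra hvan
    obtain ⟨ℓ', s', h₁, h₂⟩ := exists_shorter_of_vanishing v ξ hvξ hvan
    have := hshort _ _ h₂
    omega
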